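/- arXiv:1105.4138 — 4 statements merged into one kernel-verified Lean document; each statement's English description precedes it below -/
import Mathlib

section
/- For every real k₀ ≠ 0 and every k ∈ ℝ³, writing e(k) = |k|² − 1, one has the parametric representation exp(−(k₀² + e(k)²)) / (i k₀ + e(k)) = ∫₁^∞ ( ∫_ℝ (−i k₀ + e(k)) · (2√(πα))^{−1} · exp(−α k₀²) · exp(−β²/(4α)) · exp(iβ e(k)) dβ ) dα, where the iterated integral converges absolutely. -/
open MeasureTheory

noncomputable section

/-- The integrand of the parametric (Schwinger) representation of the cutoff propagator,
with `e(k) = |k|² − 1`. -/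
def paramIntegrand (k₀ : ℝ) (k : EuclideanSpace ℝ (Fin 3)) (α β : ℝ) : ℂ :=
  (-(Complex.I * (k₀ : ℂ)) + ((‖k‖ ^ 2 - 1 : ℝ) : ℂ)) *
    (((2 * Real.sqrt (Real.pi * α) : ℝ) : ℂ))⁻¹ *
    Complex.exp (-((α * k₀ ^ 2 : ℝ) : ℂ)) *
    Complex.exp (-((β ^ 2 / (4 * α) : ℝ) : ℂ)) *
    Complex.exp (Complex.I * (β : ℂ) * ((‖k‖ ^ 2 - 1 : ℝ) : ℂ))

theorem sqrt_pi_div_inv_four_mul (α : ℝ) :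
    Real.sqrt (Real.pi / (4 * α)⁻¹) = 2 * Real.sqrt (Real.pi * α) := by
  rw [div_inv_eq_mul, show Real.pi * (4 * α) = 2 ^ 2 * (Real.pi * α) by ring,
    Real.sqrt_mul (by norm_num), Real.sqrt_sq (by norm_num)]

theorem integral_cexp_neg_sq_div_mul_cexp {α : ℝ} (hα : 0 < α) (e : ℝ) :
    ∫ β : ℝ, Complex.exp (-((β ^ 2 / (4 * α) : ℝ) : ℂ)) *
        Complex.exp (Complex.I * (β : ℂ) * (e : ℂ)) =
       ((2 * Real.sqrt (Real.pi * α) : ℝ) : ℂ) * Complex.exp (-((α * e ^ 2 : ℝ) : ℂ)) := by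
  have hα' : (α : ℂ) ≠ 0 := by exact_mod_cast hα.ne'
  have hb : 0 < (((4 * α)⁻¹ : ℝ) : ℂ).re := by rw [Complex.ofReal_re]; positivity
  have h := fourierIntegral_gaussian hb (e : ℂ)
  have hs : ((Real.pi : ℂ) / (((4 * α)⁻¹ : ℝ) : ℂ)) ^ (1 / 2 : ℂ)
      = ((2 * Real.sqrt (Real.pi * α) : ℝ) : ℂ) := by
    have hpos : 0 ≤ Real.pi / (4 * α)⁻¹ := by positivity
    rw [← sqrt_pi_div_inv_four_mul α, Real.sqrt_eq_rpow, Complex.ofReal_cpow hpos]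
    push_cast
    rfl
  rw [hs] at h
  convert h using 1
  · refine integral_congr_ae (.of_forall fun β => ?_)
    simp only
    rw [mul_comm]
    congr 2
    · ring
    · push_cast
      field_simp
  · congr 2
    push_cast
    field_simp

theorem integral_paramIntegrand (k₀ : ℝ) (k : EuclideanSpace ℝ (Fin 3)) {α : ℝ} (hα : 0 < α) :
    ∫ β : ℝ, paramIntegrand k₀ k α β =
      (-(Complex.I * (k₀ : ℂ)) + ((‖k‖ ^ 2 - 1 : ℝ) : ℂ)) *
        Complex.exp (((-(k₀ ^ 2 + (‖k‖ ^ 2 - 1) ^ 2) : ℝ) : ℂ) * α) := by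
  have hs : ((2 * Real.sqrt (Real.pi * α) : ℝ) : ℂ) ≠ 0 := by
    have := Real.pi_pos
    exact_mod_cast (by positivity : 2 * Real.sqrt (Real.pi * α) ≠ 0)
  have hexp : Complex.exp (((-(k₀ ^ 2 + (‖k‖ ^ 2 - 1) ^ 2) : ℝ) : ℂ) * α) =
      Complex.exp (-((α * k₀ ^ 2 : ℝ) : ℂ)) *
        Complex.exp (-((α * (‖k‖ ^ 2 - 1) ^ 2 : ℝ) : ℂ)) := by
    rw [← Complex.exp_add]
    congr 1
    push_cast
    ring
  simp only [paramIntegrand, mul_assoc _ (Complex.exp (-((_ / _ : ℝ) : ℂ))) _]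
  rw [integral_const_mul, integral_cexp_neg_sq_div_mul_cexp hα, hexp]
  field_simp

theorem norm_paramIntegrand (k₀ : ℝ) (k : EuclideanSpace ℝ (Fin 3)) (α β : ℝ) :
    ‖paramIntegrand k₀ k α β‖ =
      ‖-(Complex.I * (k₀ : ℂ)) + ((‖k‖ ^ 2 - 1 : ℝ) : ℂ)‖ *
        (2 * Real.sqrt (Real.pi * α))⁻¹ * Real.exp (-(α * k₀ ^ 2)) *
        Real.exp (-(4 * α)⁻¹ * β ^ 2) := by
  have h1 : ‖Complex.exp (Complex.I * (β : ℂ) * ((‖k‖ ^ 2 - 1 : ℝ) : ℂ))‖ = 1 := by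
    rw [mul_assoc, ← Complex.ofReal_mul, mul_comm, Complex.norm_exp_ofReal_mul_I]
  rw [paramIntegrand, norm_mul, norm_mul, norm_mul, norm_mul, h1, mul_one, norm_inv,
    Complex.norm_real, Real.norm_of_nonneg (by positivity), ← Complex.ofReal_neg,
    ← Complex.ofReal_neg, Complex.norm_exp_ofReal, Complex.norm_exp_ofReal]
  ring_nf

theorem integral_norm_paramIntegrand (k₀ : ℝ) (k : EuclideanSpace ℝ (Fin 3)) {α : ℝ}
    (hα : 0 < α) :
    ∫ β : ℝ, ‖paramIntegrand k₀ k α β‖ =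
      ‖-(Complex.I * (k₀ : ℂ)) + ((‖k‖ ^ 2 - 1 : ℝ) : ℂ)‖ * Real.exp (-k₀ ^ 2 * α) := by
  have hπ := Real.pi_pos
  have hne : 2 * Real.sqrt (Real.pi * α) ≠ 0 := by positivity
  simp only [norm_paramIntegrand]
  rw [integral_const_mul, integral_gaussian, sqrt_pi_div_inv_four_mul, mul_right_comm,
    inv_mul_cancel_right₀ hne, mul_comm α, neg_mul]

theorem measurable_uncurry_paramIntegrand (k₀ : ℝ) (k : EuclideanSpace ℝ (Fin 3)) :
    Measurable (Function.uncurry (paramIntegrand k₀ k)) := by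
  unfold Function.uncurry paramIntegrand
  fun_prop

theorem integrable_uncurry_paramIntegrand {k₀ : ℝ} (hk₀ : k₀ ≠ 0)
    (k : EuclideanSpace ℝ (Fin 3)) :
    Integrable (Function.uncurry (paramIntegrand k₀ k))
      ((volume.restrict (Set.Ici (1 : ℝ))).prod volume) := by
  have hmeas := measurable_uncurry_paramIntegrand k₀ k
  refine (integrable_prod_iff hmeas.aestronglyMeasurable).2 ⟨?_, ?_⟩
  · filter_upwards [ae_restrict_mem measurableSet_Ici] with α hα
    have hα : 0 < α := one_pos.trans_le hα
    refine (integrable_norm_iff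
      (hmeas.comp measurable_prodMk_left).aestronglyMeasurable).1 ?_
    simp only [Function.comp_def, Function.uncurry_apply_pair, norm_paramIntegrand]
    exact (integrable_exp_neg_mul_sq (by positivity)).const_mul _
  · refine Integrable.congr (f := fun α : ℝ =>
      ‖-(Complex.I * (k₀ : ℂ)) + ((‖k‖ ^ 2 - 1 : ℝ) : ℂ)‖ * Real.exp (-k₀ ^ 2 * α)) ?_ ?_
    · have : -k₀ ^ 2 < 0 := by have := sq_pos_of_ne_zero hk₀; linarith
      exact ((integrableOn_Ici_iff_integrableOn_Ioi).2
        (integrableOn_exp_mul_Ioi this 1)).const_mul _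
    · filter_upwards [ae_restrict_mem measurableSet_Ici] with α hα
      exact (integral_norm_paramIntegrand k₀ k (one_pos.trans_le hα)).symm

/-- for every real `k₀ ≠ 0` and every `k ∈ ℝ³`, writing `e(k) = |k|² − 1`,
`exp(−(k₀²+e(k)²))/(i k₀+e(k)) = ∫₁^∞ (∫_ℝ (−i k₀+e(k))·(2√(πα))^{−1}·exp(−α k₀²)·exp(−β²/(4α))·exp(iβ e(k)) dβ) dα`,
and the iterated integral converges absolutely. -/
theorem parametric_representation_momentum_space (k₀ : ℝ) (hk₀ : k₀ ≠ 0)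
    (k : EuclideanSpace ℝ (Fin 3)) :
    Integrable (Function.uncurry (paramIntegrand k₀ k))
      ((volume.restrict (Set.Ici (1:ℝ))).prod volume) ∧
    Complex.exp (-((k₀ ^ 2 + (‖k‖ ^ 2 - 1) ^ 2 : ℝ) : ℂ)) /
        (Complex.I * (k₀ : ℂ) + ((‖k‖ ^ 2 - 1 : ℝ) : ℂ)) =
      ∫ α in Set.Ici (1:ℝ), ∫ β : ℝ, paramIntegrand k₀ k α β := by
  refine ⟨integrable_uncurry_paramIntegrand hk₀ k, ?_⟩
  have hpos : 0 < k₀ ^ 2 + (‖k‖ ^ 2 - 1) ^ 2 := by positivity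
  have hre : (((-(k₀ ^ 2 + (‖k‖ ^ 2 - 1) ^ 2) : ℝ) : ℂ)).re < 0 := by
    rw [Complex.ofReal_re]; linarith
  have hfac : (Complex.I * (k₀ : ℂ) + ((‖k‖ ^ 2 - 1 : ℝ) : ℂ)) *
      (-(Complex.I * (k₀ : ℂ)) + ((‖k‖ ^ 2 - 1 : ℝ) : ℂ)) =
        ((k₀ ^ 2 + (‖k‖ ^ 2 - 1) ^ 2 : ℝ) : ℂ) := by
    push_cast
    linear_combination -(k₀ : ℂ) ^ 2 * Complex.I_sq
  have hne : ((k₀ ^ 2 + (‖k‖ ^ 2 - 1) ^ 2 : ℝ) : ℂ) ≠ 0 := by exact_mod_cast hpos.ne'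
  have hden : Complex.I * (k₀ : ℂ) + ((‖k‖ ^ 2 - 1 : ℝ) : ℂ) ≠ 0 :=
    left_ne_zero_of_mul (hfac ▸ hne)
  rw [setIntegral_congr_fun measurableSet_Ici fun α hα =>
      integral_paramIntegrand k₀ k (one_pos.trans_le hα),
    integral_Ici_eq_integral_Ioi, integral_const_mul, integral_exp_mul_complex_Ioi hre,
    Complex.ofReal_neg, Complex.ofReal_one, mul_one, neg_div_neg_eq, div_eq_iff hden,
    mul_right_comm, mul_comm _ (Complex.I * _ + _), hfac, mul_div_cancel₀ _ hne]
end
end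

section
/- Let 0 < j < j_m, α ≥ 1 and β ∈ ℝ. (i) If 1 ≤ k ≤ k_m(j) and χ_{jk}(α,β) ≠ 0, then α ≥ β²/2. (ii) If moreover j ≥ 2 and χ_{j0}(α,β) ≠ 0 (the case k = 0), then α ≤ 8M³·β². -/
open MeasureTheory Filter Set

noncomputable section

/-- The temperature scale `j_m = 1 + ⌊log(1/T)/log M⌋`. -/
def jmax (M T : ℝ) : ℕ := 1 + ⌊Real.log (1 / T) / Real.log M⌋₊

/-- The maximal auxiliary scale `k_m(j) = min(j_m − j, 3j)`. -/
def kmax (M T : ℝ) (j : ℕ) : ℕ := min (jmax M T - j) (3 * j)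

/-- `X_{αβ} = (1+β²)^{3/4}·(α+β²)^{1/4}`. -/
def Xab (α β : ℝ) : ℝ := (1 + β ^ 2) ^ ((3:ℝ)/4) * (α + β ^ 2) ^ ((1:ℝ)/4)

/-- The main slice cutoff `χ_j`: `χ_0(X) = u(X)`;
`χ_j(X) = u(X/M^{2j}) − u(X/M^{2j−2})` for `0 < j < j_m`;
`χ_{j_m}(X) = 1 − u(X/M^{2j_m−2})`. -/
def chiMain (u : ℝ → ℝ) (M : ℝ) (jm j : ℕ) (X : ℝ) : ℝ :=
  if j = 0 then u X
  else if j = jm then 1 - u (X / M ^ (2 * jm - 2))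
  else u (X / M ^ (2 * j)) - u (X / M ^ (2 * j - 2))

/-- The auxiliary slice cutoff `χ̃_k` (at main scale `j`): if `k_m(j) = 0` then `χ̃_0 ≡ 1`;
otherwise `χ̃_0(α) = u(α/M^{2j})`, `χ̃_k(α) = u(α/M^{2j+2k}) − u(α/M^{2j+2k−2})` for
`0 < k < k_m(j)` and `χ̃_{k_m(j)}(α) = 1 − u(α/M^{2j+2k_m(j)})`. -/
def chiAux (u : ℝ → ℝ) (M T : ℝ) (j k : ℕ) (α : ℝ) : ℝ :=
  if kmax M T j = 0 then 1
  else if k = 0 then u (α / M ^ (2 * j))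
  else if k = kmax M T j then 1 - u (α / M ^ (2 * j + 2 * kmax M T j))
  else u (α / M ^ (2 * j + 2 * k)) - u (α / M ^ (2 * j + 2 * k - 2))

/-- `χ_{jk}(α,β) = χ_j(X_{αβ})·χ̃_k(α)`. -/
def chiJK (u : ℝ → ℝ) (M T : ℝ) (j k : ℕ) (α β : ℝ) : ℝ :=
  chiMain u M (jmax M T) j (Xab α β) * chiAux u M T j k α

theorem Xab_nonneg {α : ℝ} (hα : 0 ≤ α) (β : ℝ) : 0 ≤ Xab α β := by
  unfold Xab
  positivity

theorem Xab_pow_four {α : ℝ} (hα : 0 ≤ α) (β : ℝ) :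
    Xab α β ^ 4 = (1 + β ^ 2) ^ 3 * (α + β ^ 2) := by
  have h1 : (0 : ℝ) ≤ 1 + β ^ 2 := by positivity
  have h2 : 0 ≤ α + β ^ 2 := by positivity
  rw [Xab, mul_pow, ← Real.rpow_mul_natCast h1, ← Real.rpow_mul_natCast h2,
    ← Real.rpow_natCast (1 + β ^ 2) 3]
  norm_num

/-- A difference of two dilates of a cutoff is supported in the annulus between their scales. -/
theorem mem_Ioo_of_cutoff_sub_ne_zero {u : ℝ → ℝ} (hu1 : ∀ x : ℝ, x ≤ 1 → u x = 1)
    (hu2 : ∀ x : ℝ, 2 ≤ x → u x = 0) {a b x : ℝ} (ha : 0 < a) (hab : a ≤ b)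
    (h : u (x / b) - u (x / a) ≠ 0) : x ∈ Ioo a (2 * b) := by
  have hb : 0 < b := ha.trans_le hab
  constructor
  · by_contra! hx
    refine h ?_
    rw [hu1 _ ((div_le_one hb).2 (hx.trans hab)), hu1 _ ((div_le_one ha).2 hx), sub_self]
  · by_contra! hx
    refine h ?_
    rw [hu2 _ ((le_div_iff₀ hb).2 hx), hu2 _ ((le_div_iff₀ ha).2 (by linarith)), sub_self]

theorem mem_Ioo_of_chiMain_ne_zero {u : ℝ → ℝ} (hu1 : ∀ x : ℝ, x ≤ 1 → u x = 1)
    (hu2 : ∀ x : ℝ, 2 ≤ x → u x = 0) {M : ℝ} (hM : 1 ≤ M) {jm j : ℕ} (hj0 : 0 < j)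
    (hjm : j < jm) {X : ℝ} (h : chiMain u M jm j X ≠ 0) :
    X ∈ Ioo (M ^ (2 * j - 2)) (2 * M ^ (2 * j)) := by
  rw [chiMain, if_neg hj0.ne', if_neg hjm.ne] at h
  exact mem_Ioo_of_cutoff_sub_ne_zero hu1 hu2 (by positivity)
    (pow_le_pow_right₀ hM (by omega)) h

theorem pow_lt_of_chiAux_ne_zero {u : ℝ → ℝ} (hu1 : ∀ x : ℝ, x ≤ 1 → u x = 1)
    (hu2 : ∀ x : ℝ, 2 ≤ x → u x = 0) {M T : ℝ} (hM : 1 ≤ M) {j k : ℕ} (hk : 1 ≤ k)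
    (hkm : k ≤ kmax M T j) {α : ℝ} (h : chiAux u M T j k α ≠ 0) : M ^ (2 * j) < α := by
  rw [chiAux, if_neg (by omega), if_neg (by omega)] at h
  split_ifs at h with hk'
  · by_contra! hα
    refine h ?_
    have hle : M ^ (2 * j) ≤ M ^ (2 * j + 2 * kmax M T j) :=
      pow_le_pow_right₀ hM (by omega)
    rw [hu1 _ ((div_le_one (by positivity)).2 (hα.trans hle)), sub_self]
  · exact (pow_le_pow_right₀ hM (by omega)).trans_lt
      (mem_Ioo_of_cutoff_sub_ne_zero hu1 hu2 (by positivity)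
        (pow_le_pow_right₀ hM (by omega)) h).1

theorem lt_of_chiAux_zero_ne_zero {u : ℝ → ℝ} (hu2 : ∀ x : ℝ, 2 ≤ x → u x = 0) {M T : ℝ}
    (hM : 0 < M) {j : ℕ} (hkm : kmax M T j ≠ 0) {α : ℝ} (h : chiAux u M T j 0 α ≠ 0) :
    α < 2 * M ^ (2 * j) := by
  rw [chiAux, if_neg hkm, if_pos rfl] at h
  by_contra! hα
  exact h (hu2 _ ((le_div_iff₀ (by positivity)).2 hα))

theorem half_sq_le_of_Xab_lt {α β : ℝ} (hα : 0 ≤ α) (h : Xab α β < 2 * α) :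
    β ^ 2 / 2 ≤ α := by
  by_contra! hβ
  have h4 := pow_le_pow_left₀ (Xab_nonneg hα β) h.le 4
  rw [Xab_pow_four hα] at h4
  have h3 : (2 * α) ^ 3 ≤ (1 + β ^ 2) ^ 3 := pow_le_pow_left₀ (by positivity) (by linarith) 3
  have hpos : 0 < α := by
    have := Xab_nonneg hα β
    linarith
  have : (2 * α) ^ 3 * (3 * α) ≤ (1 + β ^ 2) ^ 3 * (α + β ^ 2) :=
    mul_le_mul h3 (by linarith) (by positivity) (by positivity)
  nlinarith [pow_pos hpos 4]

theorem le_mul_sq_of_lt_Xab {M N α β : ℝ} (hM : 2 ≤ M) (hN : 2 ≤ N) (hα : 0 ≤ α)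
    (hαN : α < 2 * (N * M ^ 3)) (hX : N * M < Xab α β) : α ≤ 8 * M ^ 3 * β ^ 2 := by
  by_contra! hβ
  have hM3 : 8 ≤ M ^ 3 := by
    have := pow_le_pow_left₀ (by norm_num) hM 3
    linarith
  have h4 := pow_le_pow_left₀ (by positivity) hX.le 4
  rw [Xab_pow_four hα] at h4
  have hb : β ^ 2 ≤ N / 4 := by
    by_contra! hb
    nlinarith [mul_lt_mul_of_pos_left hb (by positivity : 0 < 8 * M ^ 3)]
  have h1 : (1 + β ^ 2) ^ 3 ≤ (3 / 4 * N) ^ 3 :=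
    pow_le_pow_left₀ (by positivity) (by linarith) 3
  have h2 : α + β ^ 2 ≤ 65 / 32 * (N * M ^ 3) := by
    nlinarith [mul_le_mul_of_nonneg_left hM3 (by positivity : 0 ≤ N)]
  have h5 := mul_le_mul h1 h2 (by positivity) (by positivity)
  have hpos : 0 < N ^ 4 * M ^ 3 := by positivity
  nlinarith [mul_le_mul_of_nonneg_left hM hpos.le]

/-- let `0 < j < j_m`, `α ≥ 1`, `β ∈ ℝ`.
(i) If `1 ≤ k ≤ k_m(j)` and `χ_{jk}(α,β) ≠ 0` then `α ≥ β²/2`.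
(ii) If moreover `j ≥ 2` and `χ_{j0}(α,β) ≠ 0` then `α ≤ 8M³·β²`. -/
theorem slicing_support_alpha_beta (M T : ℝ) (hM : 2 ≤ M) (hT0 : 0 < T) (hT1 : T ≤ 1)
    (u : ℝ → ℝ) (hu01 : ∀ x, 0 ≤ u x ∧ u x ≤ 1)
    (hu1 : ∀ x : ℝ, x ≤ 1 → u x = 1) (hu2 : ∀ x : ℝ, 2 ≤ x → u x = 0)
    (j : ℕ) (hj0 : 0 < j) (hjm : j < jmax M T) (α β : ℝ) (hα : 1 ≤ α) :
    (∀ k : ℕ, 1 ≤ k → k ≤ kmax M T j → chiJK u M T j k α β ≠ 0 → β ^ 2 / 2 ≤ α) ∧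
    (2 ≤ j → chiJK u M T j 0 α β ≠ 0 → α ≤ 8 * M ^ 3 * β ^ 2) := by
  have hM1 : 1 ≤ M := by linarith
  have hα0 : 0 ≤ α := by linarith
  refine ⟨fun k hk hkm h => ?_, fun hj2 h => ?_⟩
  · have hX := mem_Ioo_of_chiMain_ne_zero hu1 hu2 hM1 hj0 hjm (left_ne_zero_of_mul h)
    have hA := pow_lt_of_chiAux_ne_zero hu1 hu2 hM1 hk hkm (right_ne_zero_of_mul h)
    exact half_sq_le_of_Xab_lt hα0 (by linarith [hX.2])
  · have hX := (mem_Ioo_of_chiMain_ne_zero hu1 hu2 hM1 hj0 hjm (left_ne_zero_of_mul h)).1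
    have hkm : kmax M T j ≠ 0 := by
      unfold kmax
      omega
    have hA := lt_of_chiAux_zero_ne_zero hu2 (by linarith) hkm (right_ne_zero_of_mul h)
    obtain ⟨i, rfl⟩ := Nat.exists_eq_add_of_le' hj2
    refine le_mul_sq_of_lt_Xab (N := M ^ (2 * i + 1)) hM
      (hM.trans (le_self_pow₀ hM1 (by omega))) hα0 ?_ ?_
    · rwa [← pow_add]
    · rwa [← pow_succ]
end
end

section
/- There exists a constant C > 0 such that for all T > 0 and all α > 0 with αT² ≤ 1: √α·T·∑_{n∈ℤ} [ 1 + (sinh(4πTα|k₀|)/(2πT√α)) · exp(−4π²T²α) ] · exp(−α k₀²) ≤ C, where k₀ = (2n+1)πT. -/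
noncomputable section

/-- The fermionic Matsubara frequency `k₀ = (2n+1)πT`. -/
def matsubara (T : ℝ) (n : ℤ) : ℝ := (2 * (n : ℝ) + 1) * Real.pi * T

theorem Real.sinh_le_mul_exp (x : ℝ) : Real.sinh x ≤ x * Real.exp x := by
  have h : 1 - 2 * x ≤ Real.exp (-(2 * x)) := Real.one_sub_le_exp_neg _
  have e : Real.exp (-x) = Real.exp x * Real.exp (-(2 * x)) := by
    rw [← Real.exp_add]; congr 1; ring
  rw [Real.sinh_eq, e]
  nlinarith [mul_le_mul_of_nonneg_left h (Real.exp_pos x).le]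

/-- A Gaussian corrected by a `sinh` term is dominated by an exponential, uniformly in the
dimensionless scale `s ≤ 1`. -/
theorem sinh_corrected_gaussian_le {s m : ℝ} (hs : 0 < s) (hs1 : s ≤ 1) (hm : 0 ≤ m) :
    (1 + Real.sinh (4 * Real.pi ^ 2 * s ^ 2 * m) / (2 * Real.pi * s) *
        Real.exp (-(4 * Real.pi ^ 2 * s ^ 2))) * Real.exp (-(Real.pi ^ 2 * s ^ 2 * m ^ 2)) ≤
      (Real.exp 1 + 2 * Real.pi * Real.exp 5) * Real.exp (-(s * m)) := by
  have hpi : 1 ≤ Real.pi ^ 2 := by nlinarith [Real.pi_gt_three]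
  have hp := Real.pi_pos
  have hy : 0 ≤ s * m := by positivity
  have gaussian : Real.exp (-(Real.pi ^ 2 * s ^ 2 * m ^ 2)) ≤
      Real.exp 1 * Real.exp (-(s * m)) := by
    rw [← Real.exp_add, Real.exp_le_exp]
    nlinarith [sq_nonneg (s * m - 1), mul_le_mul_of_nonneg_right hpi (sq_nonneg (s * m))]
  have quotient : Real.sinh (4 * Real.pi ^ 2 * s ^ 2 * m) / (2 * Real.pi * s) ≤
      2 * Real.pi * Real.exp (s * m) * Real.exp (4 * Real.pi ^ 2 * s ^ 2 * m) := by
    rw [div_le_iff₀ (by positivity)]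
    refine (Real.sinh_le_mul_exp _).trans ?_
    have h : s * m ≤ Real.exp (s * m) := by linarith [Real.add_one_le_exp (s * m)]
    calc 4 * Real.pi ^ 2 * s ^ 2 * m * Real.exp (4 * Real.pi ^ 2 * s ^ 2 * m)
        = 2 * Real.pi * (s * m) * Real.exp (4 * Real.pi ^ 2 * s ^ 2 * m) *
            (2 * Real.pi * s) := by ring
      _ ≤ _ := by gcongr
  have shifted : Real.exp (s * m) * Real.exp (4 * Real.pi ^ 2 * s ^ 2 * m) *
      Real.exp (-(4 * Real.pi ^ 2 * s ^ 2)) * Real.exp (-(Real.pi ^ 2 * s ^ 2 * m ^ 2)) ≤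
      Real.exp 5 * Real.exp (-(s * m)) := by
    rw [← Real.exp_add, ← Real.exp_add, ← Real.exp_add, ← Real.exp_add, Real.exp_le_exp]
    nlinarith [sq_nonneg (s * m - 2 * s - 1),
      mul_le_mul_of_nonneg_right hpi (sq_nonneg (s * m - 2 * s))]
  calc _ = Real.exp (-(Real.pi ^ 2 * s ^ 2 * m ^ 2)) +
        Real.sinh (4 * Real.pi ^ 2 * s ^ 2 * m) / (2 * Real.pi * s) *
        Real.exp (-(4 * Real.pi ^ 2 * s ^ 2)) *
          Real.exp (-(Real.pi ^ 2 * s ^ 2 * m ^ 2)) := by ring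
    _ ≤ Real.exp 1 * Real.exp (-(s * m)) +
        2 * Real.pi * Real.exp (s * m) * Real.exp (4 * Real.pi ^ 2 * s ^ 2 * m) *
        Real.exp (-(4 * Real.pi ^ 2 * s ^ 2)) *
          Real.exp (-(Real.pi ^ 2 * s ^ 2 * m ^ 2)) := by gcongr
    _ ≤ _ := by
      nlinarith [mul_le_mul_of_nonneg_left shifted (by positivity : 0 ≤ 2 * Real.pi)]

theorem hasSum_exp_neg_mul_abs_int {s : ℝ} (hs : 0 < s) :
    HasSum (fun n : ℤ => Real.exp (-(s * |(n : ℝ)|)))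
      ((1 + Real.exp (-s)) / (1 - Real.exp (-s))) := by
  have hr : Real.exp (-s) < 1 := by simpa using hs
  have hg := hasSum_geometric_of_lt_one (Real.exp_pos (-s)).le hr
  have key : ∀ n : ℕ, Real.exp (-s) ^ n = Real.exp (-(s * (n : ℝ))) := fun n => by
    rw [← Real.exp_nat_mul]; congr 1; ring
  convert HasSum.of_nat_of_neg_add_one (f := fun n : ℤ => Real.exp (-(s * |(n : ℝ)|)))
    (m := (1 - Real.exp (-s))⁻¹) (m' := Real.exp (-s) * (1 - Real.exp (-s))⁻¹) ?_ ?_ using 1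
  · rw [div_eq_mul_inv]; ring
  · simpa [key] using hg
  · refine Eq.subst (motive := fun f => HasSum f _) (funext fun n => ?_)
      (hg.mul_left (Real.exp (-s)))
    rw [← pow_succ', key]
    push_cast
    rw [abs_neg, abs_of_nonneg (by positivity)]

theorem mul_tsum_exp_neg_mul_abs_int_le {s : ℝ} (hs : 0 < s) (hs1 : s ≤ 1) :
    s * ∑' n : ℤ, Real.exp (-(s * |(n : ℝ)|)) ≤ 4 := by
  have hr : Real.exp (-s) < 1 := by simpa using hs
  have h : (1 + s) * Real.exp (-s) ≤ 1 := by
    have h1 := mul_le_mul_of_nonneg_right (Real.add_one_le_exp s) (Real.exp_pos (-s)).le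
    rw [← Real.exp_add, add_neg_cancel, Real.exp_zero] at h1
    linarith
  rw [(hasSum_exp_neg_mul_abs_int hs).tsum_eq, mul_div_assoc', div_le_iff₀ (by linarith)]
  nlinarith [Real.exp_pos (-s)]

theorem abs_intCast_le_abs_two_mul_add_one (n : ℤ) : |(n : ℝ)| ≤ |2 * (n : ℝ) + 1| := by
  have h : |n| ≤ |2 * n + 1| := by grind
  exact_mod_cast h

/-- there is `C > 0` such that for all `T > 0` and `α > 0` with `αT² ≤ 1`:
`√α·T·∑_{n∈ℤ} [1 + (sinh(4πTα|k₀|)/(2πT√α))·exp(−4π²T²α)]·exp(−α k₀²) ≤ C`,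
with `k₀ = (2n+1)πT`. -/
theorem sinh_corrected_sum_bound :
    ∃ C : ℝ, 0 < C ∧ ∀ T α : ℝ, 0 < T → 0 < α → α * T ^ 2 ≤ 1 →
      Real.sqrt α * T * ∑' n : ℤ,
        (1 + Real.sinh (4 * Real.pi * T * α * |matsubara T n|) /
            (2 * Real.pi * T * Real.sqrt α) * Real.exp (-(4 * Real.pi ^ 2 * T ^ 2 * α))) *
          Real.exp (-(α * matsubara T n ^ 2)) ≤ C := by
  refine ⟨4 * (Real.exp 1 + 2 * Real.pi * Real.exp 5), by positivity, ?_⟩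
  intro T α hT hα h
  set K := Real.exp 1 + 2 * Real.pi * Real.exp 5
  have hK : 0 ≤ K := by positivity
  obtain ⟨s, hs_def⟩ : ∃ s, s = Real.sqrt α * T := ⟨_, rfl⟩
  have hsqrt := Real.sqrt_pos.2 hα
  have hs : 0 < s := by rw [hs_def]; positivity
  have hsq : α * T ^ 2 = s ^ 2 := by rw [hs_def, mul_pow, Real.sq_sqrt hα.le]
  have hs1 : s ≤ 1 := by nlinarith
  have bound : ∀ n : ℤ,
      (1 + Real.sinh (4 * Real.pi * T * α * |matsubara T n|) /
            (2 * Real.pi * T * Real.sqrt α) * Real.exp (-(4 * Real.pi ^ 2 * T ^ 2 * α))) *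
          Real.exp (-(α * matsubara T n ^ 2)) ≤ K * Real.exp (-(s * |(n : ℝ)|)) := by
    intro n
    have e1 : 4 * Real.pi * T * α * |matsubara T n| =
        4 * Real.pi ^ 2 * s ^ 2 * |2 * (n : ℝ) + 1| := by
      rw [matsubara, abs_mul, abs_mul, abs_of_pos hT, abs_of_pos Real.pi_pos, ← hsq]; ring
    have e2 : 2 * Real.pi * T * Real.sqrt α = 2 * Real.pi * s := by rw [hs_def]; ring
    have e3 : 4 * Real.pi ^ 2 * T ^ 2 * α = 4 * Real.pi ^ 2 * s ^ 2 := by rw [← hsq]; ring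
    have e4 : α * matsubara T n ^ 2 = Real.pi ^ 2 * s ^ 2 * |2 * (n : ℝ) + 1| ^ 2 := by
      rw [matsubara, sq_abs, ← hsq]; ring
    rw [e1, e2, e3, e4]
    refine (sinh_corrected_gaussian_le hs hs1 (abs_nonneg _)).trans ?_
    have := abs_intCast_le_abs_two_mul_add_one n
    gcongr
  have hsum : Summable fun n : ℤ => K * Real.exp (-(s * |(n : ℝ)|)) :=
    (hasSum_exp_neg_mul_abs_int hs).summable.mul_left K
  have nonneg : ∀ n : ℤ,
      0 ≤ (1 + Real.sinh (4 * Real.pi * T * α * |matsubara T n|) /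
            (2 * Real.pi * T * Real.sqrt α) * Real.exp (-(4 * Real.pi ^ 2 * T ^ 2 * α))) *
          Real.exp (-(α * matsubara T n ^ 2)) := by
    intro n
    have : 0 ≤ Real.sinh (4 * Real.pi * T * α * |matsubara T n|) :=
      Real.sinh_nonneg_iff.2 (by positivity)
    positivity
  rw [← hs_def]
  calc _ ≤ s * ∑' n : ℤ, K * Real.exp (-(s * |(n : ℝ)|)) :=
        mul_le_mul_of_nonneg_left
          ((Summable.of_nonneg_of_le nonneg bound hsum).tsum_le_tsum bound hsum) hs.le
    _ = (s * ∑' n : ℤ, Real.exp (-(s * |(n : ℝ)|))) * K := by rw [tsum_mul_left]; ring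
    _ ≤ 4 * K := mul_le_mul_of_nonneg_right (mul_tsum_exp_neg_mul_abs_int_le hs hs1) hK
end
end

section
/- Let α ≥ 1 and β ∈ ℝ satisfy χ_{j_m}(X_{αβ}) ≠ 0 (which forces X_{αβ} > M^{2j_m−2}). Then at least one of the following holds: (a) β² ≤ 1 and α ≥ M^{8j_m}/(16·M⁸); (b) 1 < β² ≤ α, α ≥ M^{2j_m}/(4M³) and β² ≥ (4M³)^{−1}·M^{8j_m/3}·α^{−1/3}; (c) β² > α and β² ≥ M^{2j_m}/(2M²). -/
open MeasureTheory Filter Set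

noncomputable section

/-- The support of the last-scale cutoff lies in `X > M^{2j-2}`. -/
theorem lt_of_chiMain_last_ne_zero {u : ℝ → ℝ} (hu1 : ∀ x : ℝ, x ≤ 1 → u x = 1)
    {M : ℝ} (hM : 0 < M) {j : ℕ} (hj : j ≠ 0) {X : ℝ} (h : chiMain u M j j X ≠ 0) :
    M ^ (2 * j - 2) < X := by
  by_contra! hX
  apply h
  have hle : X / M ^ (2 * j - 2) ≤ 1 := (div_le_one (by positivity)).2 hX
  simp [chiMain, hj, hu1 _ hle]

/-- let `α ≥ 1` and `β ∈ ℝ` satisfy `χ_{j_m}(X_{αβ}) ≠ 0`. Then at least one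
of the following holds:
(a) `β² ≤ 1` and `α ≥ M^{8j_m}/(16·M⁸)`;
(b) `1 < β² ≤ α`, `α ≥ M^{2j_m}/(4M³)` and `β² ≥ (4M³)^{−1}·M^{8j_m/3}·α^{−1/3}`;
(c) `β² > α` and `β² ≥ M^{2j_m}/(2M²)`. -/
theorem slicing_support_last_scale (M T : ℝ) (hM : 2 ≤ M) (hT0 : 0 < T) (hT1 : T ≤ 1)
    (u : ℝ → ℝ) (hu01 : ∀ x, 0 ≤ u x ∧ u x ≤ 1)
    (hu1 : ∀ x : ℝ, x ≤ 1 → u x = 1) (hu2 : ∀ x : ℝ, 2 ≤ x → u x = 0)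
    (α β : ℝ) (hα : 1 ≤ α)
    (hchi : chiMain u M (jmax M T) (jmax M T) (Xab α β) ≠ 0) :
    (β ^ 2 ≤ 1 ∧ M ^ (8 * jmax M T) / (16 * M ^ 8) ≤ α) ∨
    (1 < β ^ 2 ∧ β ^ 2 ≤ α ∧ M ^ (2 * jmax M T) / (4 * M ^ 3) ≤ α ∧
      (4 * M ^ 3)⁻¹ * M ^ (8 * (jmax M T : ℝ) / 3) * α ^ (-(1:ℝ)/3) ≤ β ^ 2) ∨
    (α < β ^ 2 ∧ M ^ (2 * jmax M T) / (2 * M ^ 2) ≤ β ^ 2) := by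
  obtain ⟨n, hn⟩ : ∃ n, jmax M T = n + 1 := ⟨_, Nat.add_comm 1 _⟩
  have hM0 : 0 < M := by linarith
  have hα0 : 0 < α := by linarith
  have hX := lt_of_chiMain_last_ne_zero hu1 hM0 (by omega) hchi
  rw [hn] at hX ⊢
  have hX4 : (M ^ (2 * n)) ^ 4 < (1 + β ^ 2) ^ 3 * (α + β ^ 2) := by
    rw [← Xab_pow_four hα0.le]
    exact pow_lt_pow_left₀ hX (by positivity) (by norm_num)
  have hP8 : M ^ (8 * (n + 1)) = (M ^ (2 * n)) ^ 4 * M ^ 8 := by ring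
  have hP2 : M ^ (2 * (n + 1)) = M ^ (2 * n) * M ^ 2 := by ring
  have hP0 : 0 < M ^ (2 * n) := by positivity
  have hb0 : 0 ≤ β ^ 2 := sq_nonneg β
  generalize β ^ 2 = b at *
  rcases le_or_gt b 1 with hb | hb
  · refine Or.inl ⟨hb, ?_⟩
    have h1 : (1 + b) ^ 3 * (α + b) ≤ 2 ^ 3 * (2 * α) := by
      gcongr <;> linarith
    rw [hP8, div_le_iff₀ (by positivity)]
    calc _ ≤ (16 * α) * M ^ 8 := by gcongr; linarith
      _ = _ := by ring
  have h2 : (1 + b) ^ 3 ≤ (2 * b) ^ 3 := by gcongr; linarith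
  rcases le_or_gt b α with hbα | hbα
  · have h3 : (M ^ (2 * n)) ^ 4 < 16 * b ^ 3 * α := by
      calc _ < _ := hX4
        _ ≤ (2 * b) ^ 3 * (2 * α) := by gcongr; linarith
        _ = _ := by ring
    refine Or.inr (Or.inl ⟨hb, hbα, ?_, ?_⟩)
    · have h4 : M ^ (2 * n) < 2 * α := by
        refine lt_of_pow_lt_pow_left₀ 4 (by positivity) (h3.trans_le ?_)
        calc 16 * b ^ 3 * α ≤ 16 * α ^ 3 * α := by gcongr
          _ = _ := by ring
      rw [hP2, div_le_iff₀ (by positivity)]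
      calc _ ≤ (2 * α) * M ^ 2 * 1 := by rw [mul_one]; gcongr
        _ ≤ (2 * α) * M ^ 2 * (2 * M) := by gcongr; linarith
        _ = _ := by ring
    · refine le_of_pow_le_pow_left₀ (n := 3) (by norm_num) hb0 ?_
      have h5 : (M ^ (8 * ((n + 1 : ℕ) : ℝ) / 3)) ^ 3 = M ^ (8 * (n + 1)) := by
        rw [← Real.rpow_mul_natCast hM0.le, ← Real.rpow_natCast]
        congr 1
        push_cast
        ring
      have h6 : (α ^ (-(1:ℝ) / 3)) ^ 3 = α⁻¹ := by
        rw [← Real.rpow_mul_natCast hα0.le, ← Real.rpow_neg_one]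
        norm_num
      rw [mul_pow, mul_pow, h5, h6, hP8, ← div_eq_mul_inv, div_le_iff₀ hα0, inv_pow,
        inv_mul_le_iff₀ (by positivity)]
      calc _ ≤ 16 * b ^ 3 * α * M ^ 8 * 1 := by rw [mul_one]; gcongr
        _ ≤ 16 * b ^ 3 * α * M ^ 8 * (4 * M) := by gcongr; linarith
        _ = _ := by ring
  · refine Or.inr (Or.inr ⟨hbα, ?_⟩)
    have h4 : M ^ (2 * n) < 2 * b := by
      refine lt_of_pow_lt_pow_left₀ 4 (by positivity) (hX4.trans_le ?_)
      calc _ ≤ (2 * b) ^ 3 * (2 * b) := by gcongr; linarith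
        _ = _ := by ring
    rw [hP2, div_le_iff₀ (by positivity)]
    calc _ ≤ (2 * b) * M ^ 2 := by gcongr
      _ = _ := by ring
end
end
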